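/- Let X take values in an arbitrary measurable space, X̂ = g(X) for a measurable finite-range g, and let U and Ũ take values in the same finite set 𝒰, with 0 < δ ≤ 1/2, such that μ-a.e. the regular conditional distributions satisfy κ_{Ũ|X̂} = κ_{Ũ|X} and d(κ_{U|X}, κ_{Ũ|X̂}) ≤ δ, and d(μ_U, μ_Ũ) ≤ δ. Then I(X;U) ≥ I(X̂;Ũ) + 2δ·|𝒰|·log δ. -/

import Mathlib

open MeasureTheory Real
open scoped ENNReal

noncomputable section

namespace IB

/-- Real-valued indicator function of a set. -/
def ind {Ω : Type*} (s : Set Ω) : Ω → ℝ := Set.indicator s (fun _ => (1 : ℝ))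

/-- Shannon entropy of a random variable with finite alphabet. -/
noncomputable def ent {Ω α : Type*} [MeasurableSpace Ω] [Fintype α]
    (μ : Measure Ω) (A : Ω → α) : ℝ :=
  ∑ a : α, Real.negMulLog ((μ (A ⁻¹' {a})).toReal)

/-- Discrete mutual information `I(A;B) = H(A) + H(B) - H(A,B)` for finite alphabets. -/
noncomputable def miFin {Ω α β : Type*} [MeasurableSpace Ω] [Fintype α] [Fintype β]
    (μ : Measure Ω) (A : Ω → α) (B : Ω → β) : ℝ :=
  ent μ A + ent μ B - ent μ (fun ω => (A ω, B ω))

/-- Mutual information of random variables with arbitrary alphabets: the supremum of the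
discrete mutual information over all measurable finite-range quantizations. -/
noncomputable def miGen {Ω α β : Type*} [MeasurableSpace Ω] [MeasurableSpace α]
    [MeasurableSpace β] (μ : Measure Ω) (A : Ω → α) (B : Ω → β) : ℝ≥0∞ :=
  ⨆ (k : ℕ) (l : ℕ) (f : α → Fin (k + 1)) (g : β → Fin (l + 1))
    (_ : Measurable f) (_ : Measurable g),
      ENNReal.ofReal (miFin μ (f ∘ A) (g ∘ B))

/-- The Markov chain `A ⊸ B ⊸ C`: conditional independence of `A` and `C` given `σ(B)`,
expressed via conditional expectations of indicator functions. -/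
def Markov {Ω α β γ : Type*} [MeasurableSpace Ω] [MeasurableSpace α] [MeasurableSpace β]
    [MeasurableSpace γ] (μ : Measure Ω) (A : Ω → α) (B : Ω → β) (C : Ω → γ) : Prop :=
  ∀ E F, MeasurableSet E → MeasurableSet F →
    μ[ind (A ⁻¹' E ∩ C ⁻¹' F) | MeasurableSpace.comap B inferInstance]
      =ᵐ[μ]
    fun ω => (μ[ind (A ⁻¹' E) | MeasurableSpace.comap B inferInstance]) ω *
             (μ[ind (C ⁻¹' F) | MeasurableSpace.comap B inferInstance]) ω

/-- `κ` is a regular conditional distribution of the finite-valued random variable `U` given the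
random variable `X`: for each `ω`, `κ ω` is a probability vector on `𝒰`; for each `u`, the map
`ω ↦ κ ω u` is `σ(X)`-measurable and agrees `μ`-a.e. with the conditional probability
`P(U = u | σ(X))`. -/
def IsRCD {Ω 𝒳 𝒰 : Type*} [MeasurableSpace Ω] [MeasurableSpace 𝒳] [Fintype 𝒰]
    (μ : Measure Ω) (X : Ω → 𝒳) (U : Ω → 𝒰) (κ : Ω → 𝒰 → ℝ) : Prop :=
  (∀ ω u, 0 ≤ κ ω u) ∧ (∀ ω, ∑ u : 𝒰, κ ω u = 1) ∧
  (∀ u, @Measurable Ω ℝ (MeasurableSpace.comap X inferInstance) _ fun ω => κ ω u) ∧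
  (∀ u, (fun ω => κ ω u) =ᵐ[μ]
    μ[ind (U ⁻¹' {u}) | MeasurableSpace.comap X inferInstance])

lemma negMulLog_le_half {x : ℝ} (hx : 0 ≤ x) : negMulLog x ≤ 1 / 2 := by
  rcases hx.eq_or_lt with rfl | hx
  · simp
  have h := log_le_sub_one_of_pos (show 0 < 1 / (2 * x) by positivity)
  rw [one_div, log_inv, log_mul two_ne_zero hx.ne'] at h
  have h2 := mul_le_mul_of_nonneg_left h hx.le
  have h3 : x * ((2 * x)⁻¹ - 1) = 1 / 2 - x := by field_simp
  rw [negMulLog]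
  nlinarith [log_two_lt_d9]

lemma log_two_le_two_mul_negMulLog {δ : ℝ} (h₁ : 1 / 4 ≤ δ) (h₂ : δ ≤ 1 / 2) :
    log 2 ≤ 2 * negMulLog δ := by
  have hmem : δ ∈ segment ℝ (1 / 4 : ℝ) (1 / 2) := by
    rw [segment_eq_Icc (by norm_num)]
    exact ⟨h₁, h₂⟩
  have h := concaveOn_negMulLog.ge_on_segment (by norm_num) (by norm_num) hmem
  have h4 : negMulLog (1 / 4) = log 2 / 2 := by
    rw [negMulLog, show (1 / 4 : ℝ) = (2 ^ 2)⁻¹ by norm_num, log_inv, log_pow]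
    push_cast
    ring
  have h2 : negMulLog (1 / 2) = log 2 / 2 := by
    rw [negMulLog, one_div, log_inv]
    ring
  rw [h4, h2, min_self] at h
  linarith

lemma log_le_neg_one_of_le_quarter {δ : ℝ} (h₀ : 0 < δ) (h : δ ≤ 1 / 4) : log δ ≤ -1 := by
  have h1 := log_le_log h₀ h
  rw [show (1 / 4 : ℝ) = (2 ^ 2)⁻¹ by norm_num, log_inv, log_pow] at h1
  push_cast at h1
  linarith [log_two_gt_d9]

lemma mul_log_div_le {x y : ℝ} (hx : 0 ≤ x) (hy : 0 < y) : x * log y - x * log x ≤ y - x := by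
  rcases hx.eq_or_lt with rfl | hx
  · simpa using hy.le
  have h := mul_le_mul_of_nonneg_left (log_le_sub_one_of_pos (div_pos hy hx)) hx.le
  rw [log_div hy.ne' hx.ne'] at h
  have h3 : x * (y / x - 1) = y - x := by field_simp
  linarith

lemma mul_log_le_mul_log {x y : ℝ} (hx : 0 ≤ x) (hxy : x ≤ y) : x * log x ≤ x * log y := by
  rcases hx.eq_or_lt with rfl | hx
  · simp
  exact mul_le_mul_of_nonneg_left (log_le_log hx hxy) hx.le

lemma negMulLog_mono_of_le_quarter {t δ : ℝ} (ht : 0 ≤ t) (h₀ : 0 < δ) (htδ : t ≤ δ)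
    (h : δ ≤ 1 / 4) : negMulLog t ≤ negMulLog δ := by
  have h1 := mul_log_div_le ht h₀
  have h2 := log_le_neg_one_of_le_quarter h₀ h
  simp only [negMulLog]
  nlinarith

lemma negMulLog_sub_le {x y δ : ℝ} (hx : 0 ≤ x) (hx1 : x ≤ 1) (hy : 0 ≤ y) (hy1 : y ≤ 1)
    (h₀ : 0 < δ) (h : δ ≤ 1 / 4) (hxy : |x - y| ≤ δ) :
    negMulLog x - negMulLog y ≤ negMulLog δ := by
  obtain ⟨hl, hr⟩ := abs_le.1 hxy
  rcases le_total x y with hle | hle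
  · rcases hy.eq_or_lt with rfl | hy
    · have : x = 0 := le_antisymm hle hx
      subst this
      simpa using negMulLog_mono_of_le_quarter le_rfl h₀ h₀.le h
    have h1 := mul_log_div_le hx hy
    have h2 := mul_nonpos_of_nonneg_of_nonpos (sub_nonneg.2 hle) (log_nonpos hy.le hy1)
    have h3 := log_le_neg_one_of_le_quarter h₀ h
    simp only [negMulLog]
    nlinarith
  · have h1 := mul_log_le_mul_log hy hle
    have h2 := mul_log_le_mul_log (sub_nonneg.2 hle) (sub_le_self x hy)
    have h3 := negMulLog_mono_of_le_quarter (sub_nonneg.2 hle) h₀ hr h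
    simp only [negMulLog] at h3 ⊢
    nlinarith

/-- Grouping form of the continuity of entropy: nonnegative vectors `a`, `b` of equal mass `p`
whose coordinates differ by at most `δ * p`. -/
lemma sum_negMulLog_sub_le {α : Type*} [Fintype α] {a b : α → ℝ} {p δ : ℝ}
    (ha : ∀ u, 0 ≤ a u) (hb : ∀ u, 0 ≤ b u) (hap : ∑ u, a u = p) (hbp : ∑ u, b u = p)
    (h₀ : 0 < δ) (h : δ ≤ 1 / 4) (hab : ∀ u, |a u - b u| ≤ δ * p) :
    ∑ u, negMulLog (a u) - ∑ u, negMulLog (b u) ≤ p * (Fintype.card α * negMulLog δ) := by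
  have hp : 0 ≤ p := hap ▸ Finset.sum_nonneg fun u _ => ha u
  have hale : ∀ u, a u ≤ p := fun u =>
    hap ▸ Finset.single_le_sum (fun v _ => ha v) (Finset.mem_univ u)
  have hble : ∀ u, b u ≤ p := fun u =>
    hbp ▸ Finset.single_le_sum (fun v _ => hb v) (Finset.mem_univ u)
  rcases hp.eq_or_lt with rfl | hp
  · have ha0 : ∀ u, a u = 0 := fun u => le_antisymm (hale u) (ha u)
    have hb0 : ∀ u, b u = 0 := fun u => le_antisymm (hble u) (hb u)
    simp [ha0, hb0]
  have hterm : ∀ u, negMulLog (a u) - negMulLog (b u) ≤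
      p * negMulLog δ + (a u - b u) * (negMulLog p / p) := by
    intro u
    have hd : |a u / p - b u / p| ≤ δ := by
      rw [← sub_div, abs_div, abs_of_pos hp, div_le_iff₀ hp]
      exact hab u
    have key := negMulLog_sub_le (div_nonneg (ha u) hp.le) ((div_le_one hp).2 (hale u))
      (div_nonneg (hb u) hp.le) ((div_le_one hp).2 (hble u)) h₀ h hd
    have e : ∀ x, negMulLog x = x / p * negMulLog p + p * negMulLog (x / p) := by
      intro x
      rw [← negMulLog_mul, mul_div_cancel₀ _ hp.ne']
    rw [e (a u), e (b u)]
    have := mul_le_mul_of_nonneg_left key hp.le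
    have e2 : (a u - b u) * (negMulLog p / p) = a u / p * negMulLog p - b u / p * negMulLog p := by
      ring
    linarith
  rw [← Finset.sum_sub_distrib]
  refine (Finset.sum_le_sum fun u _ => hterm u).trans_eq ?_
  rw [Finset.sum_add_distrib, ← Finset.sum_mul _ _ (negMulLog p / p), Finset.sum_sub_distrib,
    hap, hbp, sub_self, zero_mul, add_zero, Finset.sum_const, Finset.card_univ, nsmul_eq_mul]
  ring

lemma negMulLog_sum_le {α : Type*} [Fintype α] {a : α → ℝ} (ha : ∀ u, 0 ≤ a u) :
    negMulLog (∑ u, a u) ≤ ∑ u, negMulLog (a u) := by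
  rw [negMulLog, neg_mul, Finset.sum_mul, ← Finset.sum_neg_distrib]
  refine Finset.sum_le_sum fun u _ => ?_
  rw [negMulLog, neg_mul]
  exact neg_le_neg (mul_log_le_mul_log (ha u)
    (Finset.single_le_sum (fun v _ => ha v) (Finset.mem_univ u)))

section Entropy

variable {Ω α β : Type*} [MeasurableSpace Ω] [Fintype α] [Fintype β]

lemma ent_prodMk (μ : Measure Ω) (A : Ω → α) (B : Ω → β) :
    ent μ (fun ω => (A ω, B ω)) = ∑ a, ∑ b, negMulLog (μ.real (A ⁻¹' {a} ∩ B ⁻¹' {b})) := by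
  rw [ent, Fintype.sum_prod_type]
  simp only [← Set.singleton_prod_singleton, Set.mk_preimage_prod, measureReal_def]

lemma ent_equiv_comp {γ : Type*} [Fintype γ] (μ : Measure Ω) (A : Ω → α) (e : α ≃ γ) :
    ent μ (e ∘ A) = ent μ A := by
  rw [ent, ← e.sum_comp, ent]
  refine Finset.sum_congr rfl fun a _ => ?_
  rw [Set.preimage_comp, ← Set.image_singleton, e.preimage_image]

lemma miFin_equiv_comp {γ ζ : Type*} [Fintype γ] [Fintype ζ] (μ : Measure Ω)
    (A : Ω → α) (B : Ω → β) (e : α ≃ γ) (e' : β ≃ ζ) :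
    miFin μ (e ∘ A) (e' ∘ B) = miFin μ A B := by
  have h := ent_equiv_comp μ (fun ω => (A ω, B ω)) (e.prodCongr e')
  rw [miFin, miFin, ent_equiv_comp, ent_equiv_comp, ← h]
  rfl

lemma sum_measureReal_inter_preimage (μ : Measure Ω) [IsFiniteMeasure μ]
    [MeasurableSpace β] [MeasurableSingletonClass β] {B : Ω → β} (hB : Measurable B)
    {S : Set Ω} (hS : MeasurableSet S) :
    ∑ b, μ.real (S ∩ B ⁻¹' {b}) = μ.real S := by
  have h := sum_measureReal_preimage_singleton (μ := μ.restrict S) (f := B) Finset.univ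
    (fun b _ => hB (measurableSet_singleton b))
  rw [Finset.coe_univ, Set.preimage_univ, measureReal_restrict_apply_univ] at h
  rw [← h]
  refine Finset.sum_congr rfl fun b _ => ?_
  rw [measureReal_restrict_apply' hS, Set.inter_comm]

lemma miFin_le_ent (μ : Measure Ω) [IsFiniteMeasure μ]
    [MeasurableSpace α] [MeasurableSingletonClass α]
    [MeasurableSpace β] [MeasurableSingletonClass β] {A : Ω → α} {B : Ω → β}
    (hA : Measurable A) (hB : Measurable B) : miFin μ A B ≤ ent μ B := by
  have h : ent μ A ≤ ent μ (fun ω => (A ω, B ω)) := by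
    rw [ent_prodMk]
    refine Finset.sum_le_sum fun a _ => ?_
    rw [← measureReal_def,
      ← sum_measureReal_inter_preimage μ hB (hA (measurableSet_singleton a))]
    exact negMulLog_sum_le fun _ => measureReal_nonneg
  rw [miFin]
  linarith

lemma ent_le_card_mul_log_two (μ : Measure Ω) (A : Ω → α) :
    ent μ A ≤ Fintype.card α * log 2 := by
  refine (Finset.sum_le_card_nsmul _ _ (log 2) fun a _ => ?_).trans_eq (by simp)
  linarith [negMulLog_le_half (x := (μ (A ⁻¹' {a})).toReal) ENNReal.toReal_nonneg,
    log_two_gt_d9]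

lemma ofReal_miFin_le_miGen {𝒳 𝒴 : Type*} [MeasurableSpace 𝒳] [MeasurableSpace 𝒴]
    [MeasurableSpace α] [MeasurableSingletonClass α]
    [MeasurableSpace β] [MeasurableSingletonClass β] [Nonempty α] [Nonempty β]
    (μ : Measure Ω) (X : Ω → 𝒳) (Y : Ω → 𝒴) {f : 𝒳 → α} {g : 𝒴 → β}
    (hf : Measurable f) (hg : Measurable g) :
    ENNReal.ofReal (miFin μ (f ∘ X) (g ∘ Y)) ≤ miGen μ X Y := by
  obtain ⟨k, hk⟩ := Nat.exists_eq_succ_of_ne_zero (Fintype.card_ne_zero (α := α))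
  obtain ⟨l, hl⟩ := Nat.exists_eq_succ_of_ne_zero (Fintype.card_ne_zero (α := β))
  let e := Fintype.equivFinOfCardEq hk
  let e' := Fintype.equivFinOfCardEq hl
  rw [← miFin_equiv_comp μ (f ∘ X) (g ∘ Y) e e']
  unfold miGen
  refine le_iSup_of_le k <| le_iSup_of_le l <| le_iSup_of_le (e ∘ f) <| le_iSup_of_le (e' ∘ g) <|
    le_iSup_of_le ((measurable_of_finite e).comp hf) <|
    le_iSup_of_le ((measurable_of_finite e').comp hg) le_rfl

/-- Continuity of mutual information in the second variable, in terms of coordinatewise closeness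
of the conditional and marginal laws. -/
lemma miFin_le_miFin_add (μ : Measure Ω) [IsProbabilityMeasure μ]
    [MeasurableSpace α] [MeasurableSingletonClass α]
    [MeasurableSpace β] [MeasurableSingletonClass β] {A : Ω → α} {B C : Ω → β}
    (hA : Measurable A) (hB : Measurable B) (hC : Measurable C)
    {δ : ℝ} (h₀ : 0 < δ) (h : δ ≤ 1 / 4)
    (hBC : ∀ b, |μ.real (B ⁻¹' {b}) - μ.real (C ⁻¹' {b})| ≤ δ)
    (hABC : ∀ a b, |μ.real (A ⁻¹' {a} ∩ B ⁻¹' {b}) - μ.real (A ⁻¹' {a} ∩ C ⁻¹' {b})| ≤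
      δ * μ.real (A ⁻¹' {a})) :
    miFin μ A C ≤ miFin μ A B + 2 * (Fintype.card β * negMulLog δ) := by
  have hmarg : ent μ C - ent μ B ≤ Fintype.card β * negMulLog δ := by
    rw [ent, ent, ← Finset.sum_sub_distrib]
    refine (Finset.sum_le_card_nsmul _ _ (negMulLog δ) fun b _ => ?_).trans_eq (by simp)
    exact negMulLog_sub_le measureReal_nonneg measureReal_le_one measureReal_nonneg
      measureReal_le_one h₀ h (by rw [abs_sub_comm]; exact hBC b)
  have hjoint : ent μ (fun ω => (A ω, B ω)) - ent μ (fun ω => (A ω, C ω)) ≤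
      Fintype.card β * negMulLog δ := by
    rw [ent_prodMk, ent_prodMk, ← Finset.sum_sub_distrib]
    have hsum : ∑ a, μ.real (A ⁻¹' {a}) = 1 := by
      simpa using sum_measureReal_inter_preimage μ hA MeasurableSet.univ
    calc _ ≤ ∑ a, μ.real (A ⁻¹' {a}) * (Fintype.card β * negMulLog δ) :=
          Finset.sum_le_sum fun a _ => sum_negMulLog_sub_le (fun _ => measureReal_nonneg)
            (fun _ => measureReal_nonneg)
            (sum_measureReal_inter_preimage μ hB (hA (measurableSet_singleton a)))
            (sum_measureReal_inter_preimage μ hC (hA (measurableSet_singleton a)))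
            h₀ h (hABC a)
      _ = _ := by rw [← Finset.sum_mul, hsum, one_mul]
  rw [miFin, miFin]
  linarith

end Entropy

section IsRCD

variable {Ω 𝒳 𝒰 : Type*} [MeasurableSpace Ω] [MeasurableSpace 𝒳] [Fintype 𝒰]
  {μ : Measure Ω} {X : Ω → 𝒳} {U : Ω → 𝒰} {κ : Ω → 𝒰 → ℝ}

lemma IsRCD.integrable (h : IsRCD μ X U κ) (u : 𝒰) : Integrable (fun ω => κ ω u) μ :=
  integrable_condExp.congr (h.2.2.2 u).symm

lemma IsRCD.setIntegral [IsFiniteMeasure μ] [MeasurableSpace 𝒰] [MeasurableSingletonClass 𝒰]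
    (h : IsRCD μ X U κ) (hX : Measurable X) (hU : Measurable U) {E : Set 𝒳}
    (hE : MeasurableSet E) (u : 𝒰) :
    ∫ ω in X ⁻¹' E, κ ω u ∂μ = μ.real (X ⁻¹' E ∩ U ⁻¹' {u}) := by
  have hs := hU (measurableSet_singleton u)
  have hint : Integrable (ind (U ⁻¹' {u})) μ := (integrable_const (1 : ℝ)).indicator hs
  rw [setIntegral_congr_ae (hX hE) ((h.2.2.2 u).mono fun _ hω _ => hω),
    setIntegral_condExp hX.comap_le hint ⟨E, hE, rfl⟩]
  rw [ind, setIntegral_indicator hs, setIntegral_const, smul_eq_mul, mul_one]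

end IsRCD

/-- if `X̂ = g(X)` is a finite quantization of `X` such that `μ`-a.e.
`κ_{Ũ|X̂} = κ_{Ũ|X}` and `d(κ_{U|X}, κ_{Ũ|X̂}) ≤ δ`, and moreover `d(μ_U, μ_Ũ) ≤ δ` with
`0 < δ ≤ 1/2`, then `I(X;U) ≥ I(X̂;Ũ) + 2δ|𝒰| log δ`. -/
theorem miGen_ge_quantized
    {Ω 𝒳 𝒰 ι : Type*} [MeasurableSpace Ω] [MeasurableSpace 𝒳]
    [Fintype 𝒰] [MeasurableSpace 𝒰] [MeasurableSingletonClass 𝒰]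
    [Fintype ι] [MeasurableSpace ι] [MeasurableSingletonClass ι]
    (μ : Measure Ω) [IsProbabilityMeasure μ]
    (X : Ω → 𝒳) (U Ut : Ω → 𝒰) (g : 𝒳 → ι)
    (hX : Measurable X) (hU : Measurable U) (hUt : Measurable Ut) (hg : Measurable g)
    (δ : ℝ) (hδ0 : 0 < δ) (hδ : δ ≤ 1 / 2)
    (κU κUtX κUtXhat : Ω → 𝒰 → ℝ)
    (hκU : IsRCD μ X U κU) (hκUtX : IsRCD μ X Ut κUtX)
    (hκUtXhat : IsRCD μ (g ∘ X) Ut κUtXhat)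
    (heq : ∀ᵐ ω ∂μ, κUtXhat ω = κUtX ω)
    (hd : ∀ᵐ ω ∂μ, ∀ u, |κU ω u - κUtXhat ω u| ≤ δ)
    (hdU : ∀ u, |(μ (U ⁻¹' {u})).toReal - (μ (Ut ⁻¹' {u})).toReal| ≤ δ) :
    ENNReal.ofReal
        (miFin μ (g ∘ X) Ut + 2 * δ * (Fintype.card 𝒰 : ℝ) * Real.log δ) ≤
      miGen μ X U := by
  have hXhat : Measurable (g ∘ X) := hg.comp hX
  have hlog : 2 * δ * (Fintype.card 𝒰 : ℝ) * Real.log δ =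
      -(2 * (Fintype.card 𝒰 * negMulLog δ)) := by
    rw [negMulLog]
    ring
  rw [hlog]
  rcases le_total δ (1 / 4) with h | h
  · have hclose : ∀ i u, |μ.real ((g ∘ X) ⁻¹' {i} ∩ U ⁻¹' {u}) -
        μ.real ((g ∘ X) ⁻¹' {i} ∩ Ut ⁻¹' {u})| ≤ δ * μ.real ((g ∘ X) ⁻¹' {i}) := by
      intro i u
      rw [← hκUtXhat.setIntegral hXhat hUt (measurableSet_singleton i) u, Set.preimage_comp,
        ← hκU.setIntegral hX hU (hg (measurableSet_singleton i)) u,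
        ← integral_sub (hκU.integrable u).integrableOn (hκUtXhat.integrable u).integrableOn,
        ← Real.norm_eq_abs]
      refine norm_setIntegral_le_of_norm_le_const_ae' (measure_lt_top _ _) ?_
      filter_upwards [hd] with ω hω _
      exact hω u
    have hmi := miFin_le_miFin_add μ hXhat hU hUt hδ0 h hdU hclose
    obtain ⟨ω⟩ := nonempty_of_isProbabilityMeasure μ
    have : Nonempty ι := ⟨g (X ω)⟩
    have : Nonempty 𝒰 := ⟨U ω⟩
    refine le_trans (ENNReal.ofReal_le_ofReal ?_) (ofReal_miFin_le_miGen μ X U hg measurable_id)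
    rw [Function.id_comp]
    linarith
  · rw [ENNReal.ofReal_of_nonpos]
    · exact zero_le
    have h1 := (miFin_le_ent μ hXhat hUt).trans (ent_le_card_mul_log_two μ Ut)
    have h2 := mul_le_mul_of_nonneg_left (log_two_le_two_mul_negMulLog h hδ)
      (Nat.cast_nonneg (α := ℝ) (Fintype.card 𝒰))
    linarith

end IB
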